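/- arXiv:1102.2597 — 2 statements merged into one kernel-verified Lean document; each statement's English description precedes it below -/
import Mathlib

section
/- Let (ρ, u, m) : 𝕋³ → ℝ × ℝ² × ℝ² be a smooth periodic solution of the linear system (L) (with the first two coordinates of 𝕋³ as space variables x = (x₁,x₂) and the third as time t), and assume that ρ, u and m each have zero average over 𝕋³ for every fixed t (equivalently, zero average over the spatial torus at each time). Then there exist smooth periodic functions φ, ψ : 𝕋³ → ℝ such that ρ = (1/2)Δ_x φ, u = (1/2)(2∂_{x₁}∂_{x₂}φ, ∂_{x₂}² φ − ∂_{x₁}² φ), and m = −(1/2)∂_t ∇_x φ + ∇_x^⊥ ψ, where ∇^⊥ = (−∂_{x₂}, ∂_{x₁}). -/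
open MeasureTheory

/-- Partial derivative in x₁ of a function of (x₁, x₂, t). -/
noncomputable def dx1 (f : ℝ × ℝ × ℝ → ℝ) (p : ℝ × ℝ × ℝ) : ℝ :=
  deriv (fun s => f (s, p.2.1, p.2.2)) p.1

/-- Partial derivative in x₂ of a function of (x₁, x₂, t). -/
noncomputable def dx2 (f : ℝ × ℝ × ℝ → ℝ) (p : ℝ × ℝ × ℝ) : ℝ :=
  deriv (fun s => f (p.1, s, p.2.2)) p.2.1

/-- Partial derivative in t of a function of (x₁, x₂, t). -/
noncomputable def dt (f : ℝ × ℝ × ℝ → ℝ) (p : ℝ × ℝ × ℝ) : ℝ :=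
  deriv (fun s => f (p.1, p.2.1, s)) p.2.2

/-- A function on ℝ³ is 1-periodic in all three variables, i.e. lives on 𝕋³. -/
def Periodic3 {α : Type*} (f : ℝ × ℝ × ℝ → α) : Prop :=
  ∀ p : ℝ × ℝ × ℝ, f (p.1 + 1, p.2.1, p.2.2) = f p ∧ f (p.1, p.2.1 + 1, p.2.2) = f p ∧
    f (p.1, p.2.1, p.2.2 + 1) = f p

/-- The spatial fundamental domain of 𝕋². -/
def Q2 : Set (ℝ × ℝ) := Set.Ioo (0 : ℝ) 1 ×ˢ Set.Ioo (0 : ℝ) 1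

section ParametricIntegral

variable {E F : Type*} [NormedAddCommGroup E] [NormedSpace ℝ E] [FiniteDimensional ℝ E]
  [NormedAddCommGroup F] [NormedSpace ℝ F]

theorem hasFDerivAt_intervalIntegral_of_contDiff {f : E × ℝ → F} (hf : ContDiff ℝ 1 f)
    (a b : ℝ) (x₀ : E) :
    HasFDerivAt (fun x => ∫ s in a..b, f (x, s))
      (∫ s in a..b, (fderiv ℝ f (x₀, s)).comp (ContinuousLinearMap.inl ℝ E ℝ)) x₀ := by
  have : ProperSpace E := FiniteDimensional.proper ℝ E
  have hcont : Continuous fun q : E × ℝ =>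
      (fderiv ℝ f q).comp (ContinuousLinearMap.inl ℝ E ℝ) :=
    (hf.continuous_fderiv one_ne_zero).clm_comp continuous_const
  obtain ⟨C, hC⟩ := ((isCompact_closedBall x₀ 1).prod
    (isCompact_uIcc (a := a) (b := b))).exists_bound_of_continuousOn hcont.continuousOn
  refine intervalIntegral.hasFDerivAt_integral_of_dominated_of_fderiv_le
    (F' := fun x s => (fderiv ℝ f (x, s)).comp (ContinuousLinearMap.inl ℝ E ℝ))
    (bound := fun _ => C) (Metric.closedBall_mem_nhds x₀ one_pos) ?_ ?_ ?_ ?_ ?_ ?_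
  · exact .of_forall fun x =>
      (hf.continuous.comp (Continuous.prodMk_right x)).aestronglyMeasurable
  · exact (hf.continuous.comp (Continuous.prodMk_right x₀)).intervalIntegrable _ _
  · exact (hcont.comp (Continuous.prodMk_right x₀)).aestronglyMeasurable
  · exact .of_forall fun s hs x hx => hC (x, s) ⟨hx, Set.uIoc_subset_uIcc hs⟩
  · exact intervalIntegrable_const
  · refine .of_forall fun s _ x _ => ?_
    exact ((hf.differentiable one_ne_zero (x, s)).hasFDerivAt).comp x (hasFDerivAt_prodMk_left x s)

theorem contDiff_intervalIntegral {f : E × ℝ → F}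
    (hf : ContDiff ℝ (⊤ : ℕ∞) f) (a b : ℝ) :
    ContDiff ℝ (⊤ : ℕ∞) (fun x => ∫ s in a..b, f (x, s)) := by
  refine contDiff_infty.2 fun n => ?_
  induction n generalizing f with
  | zero =>
    refine contDiff_zero.2 (continuous_iff_continuousAt.2 fun x => ?_)
    exact (hasFDerivAt_intervalIntegral_of_contDiff (hf.of_le (mod_cast le_top)) a b x).continuousAt
  | succ n ih =>
    have hder := hasFDerivAt_intervalIntegral_of_contDiff (hf.of_le (mod_cast le_top)) a b
    rw [Nat.cast_add, Nat.cast_one, contDiff_succ_iff_fderiv_apply]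
    refine ⟨fun x => (hder x).differentiableAt, by simp, fun v => ?_⟩
    have hcont : Continuous fun q : E × ℝ =>
        (fderiv ℝ f q).comp (ContinuousLinearMap.inl ℝ E ℝ) :=
      (hf.continuous_fderiv (by simp)).clm_comp continuous_const
    have heq : (fun x => fderiv ℝ (fun x => ∫ s in a..b, f (x, s)) x v) =
        fun x => ∫ s in a..b, fderiv ℝ f (x, s) (v, 0) := by
      ext x
      have hint : IntervalIntegrable
          (fun s => (fderiv ℝ f (x, s)).comp (ContinuousLinearMap.inl ℝ E ℝ)) volume a b :=
        (hcont.comp (Continuous.prodMk_right x)).intervalIntegrable _ _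
      rw [(hder x).fderiv, ContinuousLinearMap.intervalIntegral_apply hint]
      simp
    rw [heq]
    exact ih ((hf.fderiv_right (m := (⊤ : ℕ∞)) (by simp)).clm_apply contDiff_const)

end ParametricIntegral

theorem hasDerivAt_intervalIntegral_of_contDiff {g : ℝ × ℝ → ℝ} (hg : ContDiff ℝ 1 g)
    (a b y : ℝ) :
    HasDerivAt (fun y => ∫ s in a..b, g (y, s))
      (∫ s in a..b, deriv (fun y => g (y, s)) y) y := by
  have hcont : Continuous fun q : ℝ × ℝ =>
      (fderiv ℝ g q).comp (ContinuousLinearMap.inl ℝ ℝ ℝ) :=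
    (hg.continuous_fderiv one_ne_zero).clm_comp continuous_const
  have h := (hasFDerivAt_intervalIntegral_of_contDiff hg a b y).hasDerivAt
  have hint : IntervalIntegrable
      (fun s => (fderiv ℝ g (y, s)).comp (ContinuousLinearMap.inl ℝ ℝ ℝ)) volume a b :=
    (hcont.comp (Continuous.prodMk_right y)).intervalIntegrable _ _
  rw [ContinuousLinearMap.intervalIntegral_apply hint] at h
  refine h.congr_deriv (intervalIntegral.integral_congr fun s _ => ?_)
  exact (((hg.differentiable one_ne_zero (y, s)).hasFDerivAt).comp y
    (hasFDerivAt_prodMk_left y s)).hasDerivAt.deriv.symm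

theorem eq_of_hasDerivAt_zero {f : ℝ → ℝ} (h : ∀ x, HasDerivAt f 0 x) (x y : ℝ) : f x = f y :=
  is_const_of_deriv_eq_zero (fun x => (h x).differentiableAt) (fun x => (h x).deriv) x y

section PartialDerivatives

variable {f : ℝ × ℝ × ℝ → ℝ}

theorem hasDerivAt_dx1 (hf : Differentiable ℝ f) (x y t : ℝ) :
    HasDerivAt (fun s => f (s, y, t)) (dx1 f (x, y, t)) x := by
  have : DifferentiableAt ℝ (fun s => f (s, y, t)) x := by fun_prop
  exact this.hasDerivAt

theorem hasDerivAt_dx2 (hf : Differentiable ℝ f) (x y t : ℝ) :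
    HasDerivAt (fun s => f (x, s, t)) (dx2 f (x, y, t)) y := by
  have : DifferentiableAt ℝ (fun s => f (x, s, t)) y := by fun_prop
  exact this.hasDerivAt

theorem hasDerivAt_dt (hf : Differentiable ℝ f) (x y t : ℝ) :
    HasDerivAt (fun s => f (x, y, s)) (dt f (x, y, t)) t := by
  have : DifferentiableAt ℝ (fun s => f (x, y, s)) t := by fun_prop
  exact this.hasDerivAt

theorem dx1_eq_fderiv (hf : Differentiable ℝ f) : dx1 f = fun p => fderiv ℝ f p (1, 0, 0) := by
  ext ⟨x, y, t⟩
  exact ((hf (x, y, t)).hasFDerivAt.comp_hasDerivAt x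
    ((hasDerivAt_id x).prodMk (hasDerivAt_const x (y, t)))).deriv

theorem dx2_eq_fderiv (hf : Differentiable ℝ f) : dx2 f = fun p => fderiv ℝ f p (0, 1, 0) := by
  ext ⟨x, y, t⟩
  exact ((hf (x, y, t)).hasFDerivAt.comp_hasDerivAt y
    ((hasDerivAt_const y x).prodMk ((hasDerivAt_id y).prodMk (hasDerivAt_const y t)))).deriv

theorem dt_eq_fderiv (hf : Differentiable ℝ f) : dt f = fun p => fderiv ℝ f p (0, 0, 1) := by
  ext ⟨x, y, t⟩
  exact ((hf (x, y, t)).hasFDerivAt.comp_hasDerivAt t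
    ((hasDerivAt_const t x).prodMk ((hasDerivAt_const t y).prodMk (hasDerivAt_id t)))).deriv

theorem contDiff_fderiv_apply_const (hf : ContDiff ℝ (⊤ : ℕ∞) f) (v : ℝ × ℝ × ℝ) :
    ContDiff ℝ (⊤ : ℕ∞) fun p => fderiv ℝ f p v :=
  (hf.fderiv_right (m := (⊤ : ℕ∞)) (by simp)).clm_apply contDiff_const

theorem contDiff_dx1 (hf : ContDiff ℝ (⊤ : ℕ∞) f) : ContDiff ℝ (⊤ : ℕ∞) (dx1 f) :=
  dx1_eq_fderiv (hf.differentiable (by simp)) ▸ contDiff_fderiv_apply_const hf _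

theorem contDiff_dx2 (hf : ContDiff ℝ (⊤ : ℕ∞) f) : ContDiff ℝ (⊤ : ℕ∞) (dx2 f) :=
  dx2_eq_fderiv (hf.differentiable (by simp)) ▸ contDiff_fderiv_apply_const hf _

theorem contDiff_dt (hf : ContDiff ℝ (⊤ : ℕ∞) f) : ContDiff ℝ (⊤ : ℕ∞) (dt f) :=
  dt_eq_fderiv (hf.differentiable (by simp)) ▸ contDiff_fderiv_apply_const hf _

theorem fderiv_fderiv_apply_comm (hf : ContDiff ℝ (⊤ : ℕ∞) f) (p v w : ℝ × ℝ × ℝ) :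
    fderiv ℝ (fun q => fderiv ℝ f q v) p w = fderiv ℝ (fun q => fderiv ℝ f q w) p v := by
  have hd : DifferentiableAt ℝ (fderiv ℝ f) p :=
    (hf.fderiv_right (m := (⊤ : ℕ∞)) (by simp)).differentiable (by simp) p
  have hs : IsSymmSndFDerivAt ℝ f p := hf.contDiffAt.isSymmSndFDerivAt (by
    rw [minSmoothness_of_isRCLikeNormedField]
    exact WithTop.coe_le_coe.2 le_top)
  rw [fderiv_clm_apply hd (differentiableAt_const v), fderiv_clm_apply hd (differentiableAt_const w)]
  simpa using hs.eq w v

theorem dt_dx1_comm (hf : ContDiff ℝ (⊤ : ℕ∞) f) : dt (dx1 f) = dx1 (dt f) := by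
  rw [dt_eq_fderiv ((contDiff_dx1 hf).differentiable (by simp)),
    dx1_eq_fderiv ((contDiff_dt hf).differentiable (by simp)),
    dx1_eq_fderiv (hf.differentiable (by simp)), dt_eq_fderiv (hf.differentiable (by simp))]
  exact funext fun p => fderiv_fderiv_apply_comm hf p _ _

theorem dt_dx2_comm (hf : ContDiff ℝ (⊤ : ℕ∞) f) : dt (dx2 f) = dx2 (dt f) := by
  rw [dt_eq_fderiv ((contDiff_dx2 hf).differentiable (by simp)),
    dx2_eq_fderiv ((contDiff_dt hf).differentiable (by simp)),
    dx2_eq_fderiv (hf.differentiable (by simp)), dt_eq_fderiv (hf.differentiable (by simp))]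
  exact funext fun p => fderiv_fderiv_apply_comm hf p _ _

end PartialDerivatives

section Periodic

variable {f : ℝ × ℝ × ℝ → ℝ}

theorem Periodic3.map {α β : Type*} {h : ℝ × ℝ × ℝ → α} (hh : Periodic3 h) (k : α → β) :
    Periodic3 fun p => k (h p) :=
  fun p => ⟨congrArg k (hh p).1, congrArg k (hh p).2.1, congrArg k (hh p).2.2⟩

theorem Periodic3.map₂ {α β γ : Type*} {h : ℝ × ℝ × ℝ → α} {h' : ℝ × ℝ × ℝ → β}
    (hh : Periodic3 h) (hh' : Periodic3 h') (k : α → β → γ) :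
    Periodic3 fun p => k (h p) (h' p) :=
  fun p => ⟨congrArg₂ k (hh p).1 (hh' p).1, congrArg₂ k (hh p).2.1 (hh' p).2.1,
    congrArg₂ k (hh p).2.2 (hh' p).2.2⟩

theorem Periodic3.dt (hf : Periodic3 f) : Periodic3 (dt f) := by
  refine fun p => ⟨?_, ?_, ?_⟩
  · exact congrArg (deriv · p.2.2) (funext fun s => (hf (p.1, p.2.1, s)).1)
  · exact congrArg (deriv · p.2.2) (funext fun s => (hf (p.1, p.2.1, s)).2.1)
  · refine (deriv_comp_add_const (fun s => f (p.1, p.2.1, s)) 1 p.2.2).symm.trans ?_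
    exact congrArg (deriv · p.2.2) (funext fun s => (hf (p.1, p.2.1, s)).2.2)

end Periodic

section Mean

theorem integrableOn_Q2 {E : Type*} [NormedAddCommGroup E] {h : ℝ × ℝ → E} (hh : Continuous h) :
    IntegrableOn h Q2 :=
  (hh.continuousOn.integrableOn_compact (isCompact_Icc.prod isCompact_Icc)).mono_set
    (Set.prod_mono Set.Ioo_subset_Icc_self Set.Ioo_subset_Icc_self)

theorem setIntegral_Q2 {h : ℝ × ℝ → ℝ} (hh : Continuous h) :
    ∫ x in Q2, h x = ∫ x in (0 : ℝ)..1, ∫ y in (0 : ℝ)..1, h (x, y) := by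
  simp only [intervalIntegral.integral_of_le zero_le_one, integral_Ioc_eq_integral_Ioo]
  exact setIntegral_prod h (integrableOn_Q2 hh)

theorem setIntegral_Q2_swap {h : ℝ × ℝ → ℝ} (hh : Continuous h) :
    ∫ x in Q2, h x = ∫ y in (0 : ℝ)..1, ∫ x in (0 : ℝ)..1, h (x, y) := by
  rw [← setIntegral_Q2 (h := fun x => h (x.2, x.1)) (by fun_prop)]
  exact (setIntegral_prod_swap (Set.Ioo (0 : ℝ) 1) (Set.Ioo (0 : ℝ) 1) h).symm

/-- Zero average over the spatial torus at every time. -/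
def ZeroMean (f : ℝ × ℝ × ℝ → ℝ) : Prop :=
  ∀ t : ℝ, (∫ x in Q2, f (x.1, x.2, t)) = 0

variable {f g : ℝ × ℝ × ℝ → ℝ}

theorem ZeroMean.const_mul (hf : ZeroMean f) (c : ℝ) : ZeroMean fun p => c * f p := fun t => by
  rw [integral_const_mul, hf t, mul_zero]

theorem ZeroMean.add (hf : ZeroMean f) (hg : ZeroMean g) (hfc : Continuous f)
    (hgc : Continuous g) : ZeroMean fun p => f p + g p := fun t => by
  rw [integral_add (integrableOn_Q2 (by fun_prop)) (integrableOn_Q2 (by fun_prop)), hf t, hg t,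
    add_zero]

theorem ZeroMean.sub (hf : ZeroMean f) (hg : ZeroMean g) (hfc : Continuous f)
    (hgc : Continuous g) : ZeroMean fun p => f p - g p := fun t => by
  rw [integral_sub (integrableOn_Q2 (by fun_prop)) (integrableOn_Q2 (by fun_prop)), hf t, hg t,
    sub_zero]

theorem zeroMean_fst {v : ℝ × ℝ × ℝ → ℝ × ℝ} (hv : Continuous v)
    (h : ∀ t : ℝ, (∫ x in Q2, v (x.1, x.2, t)) = 0) : ZeroMean fun p => (v p).1 := fun t => by
  have hint : IntegrableOn (fun x : ℝ × ℝ => v (x.1, x.2, t)) Q2 := integrableOn_Q2 (by fun_prop)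
  exact (fst_integral hint).symm.trans (congrArg Prod.fst (h t))

theorem zeroMean_snd {v : ℝ × ℝ × ℝ → ℝ × ℝ} (hv : Continuous v)
    (h : ∀ t : ℝ, (∫ x in Q2, v (x.1, x.2, t)) = 0) : ZeroMean fun p => (v p).2 := fun t => by
  have hint : IntegrableOn (fun x : ℝ × ℝ => v (x.1, x.2, t)) Q2 := integrableOn_Q2 (by fun_prop)
  exact (snd_integral hint).symm.trans (congrArg Prod.snd (h t))

theorem integral_dx1 (hf : ContDiff ℝ (⊤ : ℕ∞) f) (a b y t : ℝ) :
    ∫ x in a..b, dx1 f (x, y, t) = f (b, y, t) - f (a, y, t) := by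
  have := (contDiff_dx1 hf).continuous
  exact intervalIntegral.integral_eq_sub_of_hasDerivAt
    (fun x _ => hasDerivAt_dx1 (hf.differentiable (by simp)) x y t)
    (Continuous.intervalIntegrable (by fun_prop) _ _)

theorem integral_dx2 (hf : ContDiff ℝ (⊤ : ℕ∞) f) (a b x t : ℝ) :
    ∫ y in a..b, dx2 f (x, y, t) = f (x, b, t) - f (x, a, t) := by
  have := (contDiff_dx2 hf).continuous
  exact intervalIntegral.integral_eq_sub_of_hasDerivAt
    (fun y _ => hasDerivAt_dx2 (hf.differentiable (by simp)) x y t)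
    (Continuous.intervalIntegrable (by fun_prop) _ _)

theorem integral_dx1_period (hf : ContDiff ℝ (⊤ : ℕ∞) f) (hper : Periodic3 f) (y t : ℝ) :
    ∫ x in (0 : ℝ)..1, dx1 f (x, y, t) = 0 := by
  have h := (hper (0, y, t)).1
  rw [zero_add] at h
  rw [integral_dx1 hf, h, sub_self]

theorem integral_dx2_period (hf : ContDiff ℝ (⊤ : ℕ∞) f) (hper : Periodic3 f) (x t : ℝ) :
    ∫ y in (0 : ℝ)..1, dx2 f (x, y, t) = 0 := by
  have h := (hper (x, 0, t)).2.1
  rw [zero_add] at h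
  rw [integral_dx2 hf, h, sub_self]

theorem zeroMean_dx1 (hf : ContDiff ℝ (⊤ : ℕ∞) f) (hper : Periodic3 f) : ZeroMean (dx1 f) := by
  intro t
  have := (contDiff_dx1 hf).continuous
  rw [setIntegral_Q2_swap (by fun_prop)]
  simp [integral_dx1_period hf hper]

theorem zeroMean_dx2 (hf : ContDiff ℝ (⊤ : ℕ∞) f) (hper : Periodic3 f) : ZeroMean (dx2 f) := by
  intro t
  have := (contDiff_dx2 hf).continuous
  rw [setIntegral_Q2 (by fun_prop)]
  simp [integral_dx2_period hf hper]

/-- Subtracting the spatial mean changes neither smoothness, periodicity nor spatial gradients. -/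
theorem exists_zeroMean_normalization (hf : ContDiff ℝ (⊤ : ℕ∞) f) (hper : Periodic3 f) :
    ∃ g : ℝ × ℝ × ℝ → ℝ, ContDiff ℝ (⊤ : ℕ∞) g ∧ Periodic3 g ∧ ZeroMean g ∧
      dx1 g = dx1 f ∧ dx2 g = dx2 f := by
  set M : ℝ → ℝ := fun t => ∫ x in (0 : ℝ)..1, ∫ y in (0 : ℝ)..1, f (x, y, t) with hM
  have hMsmooth : ContDiff ℝ (⊤ : ℕ∞) M := by
    have h₁ : ContDiff ℝ (⊤ : ℕ∞) fun q : ℝ × ℝ => ∫ y in (0 : ℝ)..1, f (q.2, y, q.1) :=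
      contDiff_intervalIntegral (f := fun r : (ℝ × ℝ) × ℝ => f (r.1.2, r.2, r.1.1))
        (by fun_prop) 0 1
    exact contDiff_intervalIntegral h₁ 0 1
  refine ⟨fun p => f p - M p.2.2, by fun_prop, fun p => ⟨?_, ?_, ?_⟩, fun t => ?_, ?_, ?_⟩
  · simp [(hper p).1]
  · simp [(hper p).2.1]
  · have : M (p.2.2 + 1) = M p.2.2 := by
      simp only [hM]
      congr! 4 with x y
      exact (hper (_, _, p.2.2)).2.2
    simp [(hper p).2.2, this]
  · have hc := hf.continuous
    rw [integral_sub (integrableOn_Q2 (by fun_prop)) (integrableOn_Q2 (by fun_prop)),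
      setIntegral_Q2 (by fun_prop), setIntegral_Q2 (by fun_prop)]
    simp [hM]
  · ext p
    exact deriv_sub_const (f := fun s => f (s, p.2.1, p.2.2)) (M p.2.2)
  · ext p
    exact deriv_sub_const (f := fun s => f (p.1, s, p.2.2)) (M p.2.2)

end Mean

section Potential

variable {a b : ℝ × ℝ × ℝ → ℝ}

theorem hasDerivAt_integral_dx2 (ha : ContDiff ℝ (⊤ : ℕ∞) a) (r s y t : ℝ) :
    HasDerivAt (fun y => ∫ x in r..s, a (x, y, t)) (∫ x in r..s, dx2 a (x, y, t)) y :=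
  hasDerivAt_intervalIntegral_of_contDiff (g := fun q => a (q.2, q.1, t))
    ((ha.comp (by fun_prop)).of_le (mod_cast le_top)) r s y

theorem hasDerivAt_integral_dx1 (hb : ContDiff ℝ (⊤ : ℕ∞) b) (r s x t : ℝ) :
    HasDerivAt (fun x => ∫ y in r..s, b (x, y, t)) (∫ y in r..s, dx1 b (x, y, t)) x :=
  hasDerivAt_intervalIntegral_of_contDiff (g := fun q => b (q.1, q.2, t))
    ((hb.comp (by fun_prop)).of_le (mod_cast le_top)) r s x

theorem integral_fst_eq_zero (ha : ContDiff ℝ (⊤ : ℕ∞) a) (hb : ContDiff ℝ (⊤ : ℕ∞) b)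
    (hbper : Periodic3 b) (hamean : ZeroMean a) (hcurl : dx2 a = dx1 b) (y t : ℝ) :
    ∫ x in (0 : ℝ)..1, a (x, y, t) = 0 := by
  have hconst : ∀ y', ∫ x in (0 : ℝ)..1, a (x, y', t) = ∫ x in (0 : ℝ)..1, a (x, y, t) :=
    fun y' => eq_of_hasDerivAt_zero (f := fun y => ∫ x in (0 : ℝ)..1, a (x, y, t)) (fun z => by
      simpa [hcurl, integral_dx1_period hb hbper] using hasDerivAt_integral_dx2 ha 0 1 z t) y' y
  have h := hamean t
  have hc := ha.continuous
  rw [setIntegral_Q2_swap (by fun_prop)] at h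
  simpa [hconst] using h

theorem integral_snd_eq_zero (ha : ContDiff ℝ (⊤ : ℕ∞) a) (hb : ContDiff ℝ (⊤ : ℕ∞) b)
    (haper : Periodic3 a) (hbmean : ZeroMean b) (hcurl : dx2 a = dx1 b) (x t : ℝ) :
    ∫ y in (0 : ℝ)..1, b (x, y, t) = 0 := by
  have hconst : ∀ x', ∫ y in (0 : ℝ)..1, b (x', y, t) = ∫ y in (0 : ℝ)..1, b (x, y, t) :=
    fun x' => eq_of_hasDerivAt_zero (f := fun x => ∫ y in (0 : ℝ)..1, b (x, y, t)) (fun z => by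
      simpa [← hcurl, integral_dx2_period ha haper] using hasDerivAt_integral_dx1 hb 0 1 z t) x' x
  have h := hbmean t
  have hc := hb.continuous
  rw [setIntegral_Q2 (by fun_prop)] at h
  simpa [hconst] using h

/-- Poincaré lemma on the spatial torus with time as a parameter: a smooth periodic spatially
curl-free field of zero mean is the spatial gradient of a smooth periodic function of zero mean. -/
theorem exists_periodic_potential (ha : ContDiff ℝ (⊤ : ℕ∞) a) (hb : ContDiff ℝ (⊤ : ℕ∞) b)
    (haper : Periodic3 a) (hbper : Periodic3 b) (hamean : ZeroMean a) (hbmean : ZeroMean b)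
    (hcurl : dx2 a = dx1 b) :
    ∃ f : ℝ × ℝ × ℝ → ℝ, ContDiff ℝ (⊤ : ℕ∞) f ∧ Periodic3 f ∧ ZeroMean f ∧
      dx1 f = a ∧ dx2 f = b := by
  have hac := ha.continuous
  have hbc := hb.continuous
  set f : ℝ × ℝ × ℝ → ℝ := fun p =>
    (∫ s in (0 : ℝ)..p.1, a (s, p.2.1, p.2.2)) + ∫ s in (0 : ℝ)..p.2.1, b (0, s, p.2.2) with hf
  have hsmooth : ContDiff ℝ (⊤ : ℕ∞) f := by
    have heq : f = fun p => (p.1 * ∫ s in (0 : ℝ)..1, a (s * p.1, p.2.1, p.2.2)) +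
        p.2.1 * ∫ s in (0 : ℝ)..1, b (0, s * p.2.1, p.2.2) := by
      ext p
      rw [intervalIntegral.mul_integral_comp_mul_right (f := fun s => a (s, p.2.1, p.2.2)),
        intervalIntegral.mul_integral_comp_mul_right (f := fun s => b (0, s, p.2.2))]
      simp [hf]
    have h₁ : ContDiff ℝ (⊤ : ℕ∞) fun p : ℝ × ℝ × ℝ =>
        ∫ s in (0 : ℝ)..1, a (s * p.1, p.2.1, p.2.2) :=
      contDiff_intervalIntegral (f := fun q : (ℝ × ℝ × ℝ) × ℝ =>
        a (q.2 * q.1.1, q.1.2.1, q.1.2.2)) (by fun_prop) 0 1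
    have h₂ : ContDiff ℝ (⊤ : ℕ∞) fun p : ℝ × ℝ × ℝ =>
        ∫ s in (0 : ℝ)..1, b (0, s * p.2.1, p.2.2) :=
      contDiff_intervalIntegral (f := fun q : (ℝ × ℝ × ℝ) × ℝ =>
        b (0, q.2 * q.1.2.1, q.1.2.2)) (by fun_prop) 0 1
    rw [heq]
    fun_prop
  have hdx1 : dx1 f = a := by
    ext ⟨x, y, t⟩
    have hs : Continuous fun s => a (s, y, t) := by fun_prop
    exact ((hs.integral_hasStrictDerivAt 0 x).hasDerivAt.add_const
      (∫ s in (0 : ℝ)..y, b (0, s, t))).deriv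
  have hdx2 : dx2 f = b := by
    ext ⟨x, y, t⟩
    have hs : Continuous fun s => b (0, s, t) := by fun_prop
    refine ((hasDerivAt_integral_dx2 ha 0 x y t).add
      (hs.integral_hasStrictDerivAt 0 y).hasDerivAt).deriv.trans ?_
    rw [hcurl, integral_dx1 hb]
    ring
  have hper1 : ∀ x y t, f (x + 1, y, t) = f (x, y, t) := fun x y t => by
    have h := integral_dx1 hsmooth x (x + 1) y t
    have hp : Function.Periodic (fun s => a (s, y, t)) 1 := fun s => (haper (s, y, t)).1
    rw [hdx1, hp.intervalIntegral_add_eq x 0, zero_add,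
      integral_fst_eq_zero ha hb hbper hamean hcurl] at h
    linarith
  have hper2 : ∀ x y t, f (x, y + 1, t) = f (x, y, t) := fun x y t => by
    have h := integral_dx2 hsmooth y (y + 1) x t
    have hp : Function.Periodic (fun s => b (x, s, t)) 1 := fun s => (hbper (x, s, t)).2.1
    rw [hdx2, hp.intervalIntegral_add_eq y 0, zero_add,
      integral_snd_eq_zero ha hb haper hbmean hcurl] at h
    linarith
  have hper3 : ∀ x y t, f (x, y, t + 1) = f (x, y, t) := fun x y t => by
    simp only [hf]
    congr! 3 with s s
    · exact (haper (_, _, t)).2.2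
    · exact (hbper (_, _, t)).2.2
  obtain ⟨g, hg, hgper, hgmean, hg1, hg2⟩ := exists_zeroMean_normalization hsmooth
    (fun p => ⟨hper1 _ _ _, hper2 _ _ _, hper3 _ _ _⟩)
  exact ⟨g, hg, hgper, hgmean, hg1.trans hdx1, hg2.trans hdx2⟩

end Potential

theorem stmt17 (ρ : ℝ × ℝ × ℝ → ℝ) (u m : ℝ × ℝ × ℝ → ℝ × ℝ)
    (hρ : ContDiff ℝ (⊤ : ℕ∞) ρ) (hu : ContDiff ℝ (⊤ : ℕ∞) u) (hm : ContDiff ℝ (⊤ : ℕ∞) m)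
    (hρper : Periodic3 ρ) (huper : Periodic3 u) (hmper : Periodic3 m)
    -- zero spatial average at every time
    (hρavg : ∀ t : ℝ, (∫ x in Q2, ρ (x.1, x.2, t)) = 0)
    (huavg : ∀ t : ℝ, (∫ x in Q2, u (x.1, x.2, t)) = 0)
    (hmavg : ∀ t : ℝ, (∫ x in Q2, m (x.1, x.2, t)) = 0)
    -- the linear system (L), pointwise
    (hL1 : ∀ p, dt ρ p + dx1 (fun q => (m q).1) p + dx2 (fun q => (m q).2) p = 0)
    (hL2 : ∀ p, dx1 (fun q => (u q).1) p + dx2 (fun q => (u q).2 - ρ q) p = 0)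
    (hL3 : ∀ p, dx1 (fun q => (u q).2 + ρ q) p - dx2 (fun q => (u q).1) p = 0) :
    ∃ φ ψ : ℝ × ℝ × ℝ → ℝ, ContDiff ℝ (⊤ : ℕ∞) φ ∧ ContDiff ℝ (⊤ : ℕ∞) ψ ∧
      Periodic3 φ ∧ Periodic3 ψ ∧
      (∀ p, ρ p = (1 / 2) * (dx1 (dx1 φ) p + dx2 (dx2 φ) p)) ∧
      (∀ p, u p = ((1 / 2) * (2 * dx1 (dx2 φ) p),
                   (1 / 2) * (dx2 (dx2 φ) p - dx1 (dx1 φ) p))) ∧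
      (∀ p, m p = (-(1 / 2) * dt (dx1 φ) p + (-(dx2 ψ p)),
                   -(1 / 2) * dt (dx2 φ) p + dx1 ψ p)) := by
  have hu1 : ContDiff ℝ (⊤ : ℕ∞) fun q => (u q).1 := by fun_prop
  have hu2 : ContDiff ℝ (⊤ : ℕ∞) fun q => (u q).2 := by fun_prop
  have hm1 : ContDiff ℝ (⊤ : ℕ∞) fun q => (m q).1 := by fun_prop
  have hm2 : ContDiff ℝ (⊤ : ℕ∞) fun q => (m q).2 := by fun_prop
  have hu1avg := zeroMean_fst hu.continuous huavg
  have hu2avg := zeroMean_snd hu.continuous huavg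
  have hρu : ContDiff ℝ (⊤ : ℕ∞) fun q => ρ q - (u q).2 := by fun_prop
  have huρ : ContDiff ℝ (⊤ : ℕ∞) fun q => (u q).2 + ρ q := by fun_prop
  obtain ⟨f, hf, hfper, hfmean, hf1, hf2⟩ := exists_periodic_potential hρu hu1
    (hρper.map₂ huper fun r v => r - v.2) (huper.map Prod.fst)
    (ZeroMean.sub hρavg hu2avg hρ.continuous hu2.continuous) hu1avg (by
      ext p
      have hneg : dx2 (fun q => (u q).2 - ρ q) p = -dx2 (fun q => ρ q - (u q).2) p := by
        simp only [dx2, ← deriv.fun_neg, neg_sub]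
      linarith [hL2 p])
  obtain ⟨g, hg, hgper, hgmean, hg1, hg2⟩ := exists_periodic_potential hu1 huρ
    (huper.map Prod.fst) (hρper.map₂ huper fun r v => v.2 + r) hu1avg
    (ZeroMean.add hu2avg hρavg hu2.continuous hρ.continuous)
    (funext fun p => by linarith [hL3 p])
  obtain ⟨φ, hφ, hφper, -, hφ1, hφ2⟩ := exists_periodic_potential hf hg hfper hgper hfmean hgmean
    (hf2.trans hg1.symm)
  have hdtf := contDiff_dt hf
  have hdtg := contDiff_dt hg
  have hdtf_mean : ZeroMean (dt f) := by
    rw [← hφ1, dt_dx1_comm hφ]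
    exact zeroMean_dx1 (contDiff_dt hφ) hφper.dt
  have hdtg_mean : ZeroMean (dt g) := by
    rw [← hφ2, dt_dx2_comm hφ]
    exact zeroMean_dx2 (contDiff_dt hφ) hφper.dt
  have hdt_sum : ∀ p, dt (dx1 f) p + dt (dx2 g) p = 2 * dt ρ p := by
    rintro ⟨x, y, t⟩
    have hρt := hasDerivAt_dt (hρ.differentiable (by simp)) x y t
    have hut := hasDerivAt_dt (hu2.differentiable (by simp)) x y t
    rw [hf1, hg2]
    refine (congrArg₂ (· + ·) (hρt.sub hut).deriv (hut.add hρt).deriv).trans ?_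
    ring
  have hcurl : dx2 (fun q => (m q).2 + 1 / 2 * dt g q) =
      dx1 (fun q => -1 * ((m q).1 + 1 / 2 * dt f q)) := by
    ext ⟨x, y, t⟩
    have h₁ := ((hasDerivAt_dx2 (hm2.differentiable (by simp)) x y t).add
      ((hasDerivAt_dx2 (hdtg.differentiable (by simp)) x y t).const_mul (1 / 2))).deriv
    have h₂ := (((hasDerivAt_dx1 (hm1.differentiable (by simp)) x y t).add
      ((hasDerivAt_dx1 (hdtf.differentiable (by simp)) x y t).const_mul (1 / 2))).const_mul
        (-1)).deriv
    refine h₁.trans (Eq.trans ?_ h₂.symm)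
    have hsum := hdt_sum (x, y, t)
    rw [dt_dx1_comm hf, dt_dx2_comm hg] at hsum
    linarith [hL1 (x, y, t)]
  obtain ⟨ψ, hψ, hψper, -, hψ1, hψ2⟩ := exists_periodic_potential
    (a := fun q => (m q).2 + 1 / 2 * dt g q) (b := fun q => -1 * ((m q).1 + 1 / 2 * dt f q))
    (by fun_prop) (by fun_prop)
    (hmper.map₂ hgper.dt fun v r => v.2 + 1 / 2 * r)
    (hmper.map₂ hfper.dt fun v r => -1 * (v.1 + 1 / 2 * r))
    ((zeroMean_snd hm.continuous hmavg).add (hdtg_mean.const_mul _) hm2.continuous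
      (hdtg.continuous.const_mul _))
    (((zeroMean_fst hm.continuous hmavg).add (hdtf_mean.const_mul _) hm1.continuous
      (hdtf.continuous.const_mul _)).const_mul _)
    hcurl
  refine ⟨φ, ψ, hφ, hψ, hφper, hψper, fun p => ?_, fun p => ?_, fun p => ?_⟩
  · rw [hφ1, hφ2, hf1, hg2]
    ring
  · rw [hφ1, hφ2, hf1, hg1, hg2]
    ext <;> ring
  · rw [hφ1, hφ2, hψ1, hψ2]
    ext <;> ring
end

section
/- Let 𝒟 ⊂ ℝ^d be open, let 𝒪 ⊂ 𝒟 be open and bounded, and let X be a bounded subset of L²(𝒟; ℝ^N) that is closed under weak L² convergence, equipped with a metric d_X inducing on X the weak L² topology. Then the functional I : X → ℝ, I(z) = ∫_𝒪 |z(y)|² dy, is a Baire-1 function on the complete metric space (X, d_X), i.e., a pointwise limit of a sequence of d_X-continuous functions X → ℝ; consequently, the set of points of X at which I is continuous is residual in X. -/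
open MeasureTheory Filter

/-- The a.e.-defined function underlying an element of L²(𝒟; ℝ^N) regarded as a
point of the weak topology space. -/
noncomputable def toFun {d N : ℕ} (μ : Measure (EuclideanSpace ℝ (Fin d)))
    (f : WeakSpace ℝ (Lp (EuclideanSpace ℝ (Fin N)) 2 μ)) :
    EuclideanSpace ℝ (Fin d) → EuclideanSpace ℝ (Fin N) :=
  (show Lp (EuclideanSpace ℝ (Fin N)) 2 μ from f)

/-- The norm of an element of the weak space, i.e. its L² norm. -/
noncomputable def wnorm {d N : ℕ} (μ : Measure (EuclideanSpace ℝ (Fin d)))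
    (f : WeakSpace ℝ (Lp (EuclideanSpace ℝ (Fin N)) 2 μ)) : ℝ :=
  ‖show Lp (EuclideanSpace ℝ (Fin N)) 2 μ from f‖

/-- A real-valued lower semicontinuous function is continuous at residually many points. -/
theorem LowerSemicontinuous.continuousAt_mem_residual {α : Type*} [TopologicalSpace α]
    {f : α → ℝ} (hf : LowerSemicontinuous f) : {x | ContinuousAt f x} ∈ residual α := by
  have h : ∀ᶠ x in residual α, ∀ q : ℚ, x ∈ coborder (f ⁻¹' Set.Iic (q : ℝ))ᶜ :=
    eventually_countable_forall.2 fun q =>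
      coborder_mem_residual (hf.isClosed_preimage (q : ℝ)).isOpen_compl.isLocallyClosed
  filter_upwards [h] with x hx
  refine continuousAt_iff_lower_upperSemicontinuousAt.2 ⟨hf x, fun a ha => ?_⟩
  obtain ⟨q, hxq, hqa⟩ := exists_rat_btwn ha
  have hmem : x ∈ interior (f ⁻¹' Set.Iic (q : ℝ)) := by
    have hxq' : x ∉ (f ⁻¹' Set.Iic (q : ℝ))ᶜ := fun h => h hxq.le
    have hc := hx q
    rw [coborder_eq_union_closure_compl] at hc
    rw [← compl_compl (f ⁻¹' Set.Iic (q : ℝ)), interior_compl]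
    exact hc.resolve_left hxq'
  filter_upwards [mem_interior_iff_mem_nhds.1 hmem] with y hy
  exact lt_of_le_of_lt hy hqa

/-- The squared norm is the supremum of the affine minorants
`2⟪y, v⟫ - ‖y‖²`, with `y` ranging over a dense sequence. -/
theorem isLUB_range_two_mul_inner_denseSeq_sub {K : Type*} [NormedAddCommGroup K]
    [InnerProductSpace ℝ K] [TopologicalSpace.SeparableSpace K] (v : K) :
    IsLUB (Set.range fun n => 2 * inner ℝ (TopologicalSpace.denseSeq K n) v -
      ‖TopologicalSpace.denseSeq K n‖ ^ 2) (‖v‖ ^ 2) := by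
  have key (y : K) : 2 * inner ℝ y v - ‖y‖ ^ 2 = ‖v‖ ^ 2 - ‖y - v‖ ^ 2 := by
    rw [norm_sub_sq_real]; ring
  simp only [key]
  refine ⟨?_, fun b hb => ?_⟩
  · rintro _ ⟨n, rfl⟩
    exact sub_le_self _ (sq_nonneg _)
  · have hclosed : IsClosed {y : K | ‖v‖ ^ 2 - ‖y - v‖ ^ 2 ≤ b} :=
      isClosed_le (by fun_prop) continuous_const
    have hall := (TopologicalSpace.denseRange_denseSeq K).induction_on
      (p := fun y => ‖v‖ ^ 2 - ‖y - v‖ ^ 2 ≤ b) v hclosed fun n => hb ⟨n, rfl⟩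
    simpa using hall

/-- The pointwise supremum of a sequence of continuous functions is the pointwise limit of a
sequence of continuous functions, and it is continuous at residually many points. -/
theorem exists_continuous_tendsto_and_residual_of_isLUB {α : Type*} [TopologicalSpace α]
    {f : α → ℝ} {a : ℕ → α → ℝ} (ha : ∀ n, Continuous (a n))
    (hf : ∀ x, IsLUB (Set.range fun n => a n x) (f x)) :
    (∃ g : ℕ → α → ℝ, (∀ n, Continuous (g n)) ∧
      ∀ x, Tendsto (fun n => g n x) atTop (nhds (f x))) ∧
    {x | ContinuousAt f x} ∈ residual α := by
  refine ⟨⟨fun n => partialSups a n, fun n => Continuous.partialSups fun k _ => ha k,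
    fun x => ?_⟩, LowerSemicontinuous.continuousAt_mem_residual ?_⟩
  · simp only [Pi.partialSups_apply]
    refine tendsto_atTop_isLUB (partialSups_monotone _) ?_
    rw [IsLUB, upperBounds_range_partialSups]
    exact hf x
  · have hsup : f = fun x => ⨆ n, a n x := funext fun x => (hf x).ciSup_eq.symm
    rw [hsup]
    exact lowerSemicontinuous_ciSup (fun x => (hf x).bddAbove)
      fun n => (ha n).lowerSemicontinuous

/-- A continuous linear functional is continuous for the weak topology. -/
theorem WeakSpace.continuous_strongDual_apply {E : Type*} [NormedAddCommGroup E]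
    [NormedSpace ℝ E] (φ : StrongDual ℝ E) :
    Continuous fun x : WeakSpace ℝ E => φ ((toWeakSpace ℝ E).symm x) :=
  WeakBilin.eval_continuous (topDualPairing ℝ E).flip φ

/-- The squared norm in `L²` is the integral of the squared pointwise norm. -/
theorem MeasureTheory.L2.norm_sq_eq_integral {α F : Type*} [MeasurableSpace α] {μ : Measure α}
    [NormedAddCommGroup F] [InnerProductSpace ℝ F] (f : Lp F 2 μ) :
    ‖f‖ ^ 2 = ∫ x, ‖f x‖ ^ 2 ∂μ := by
  simp only [← real_inner_self_eq_norm_sq, L2.inner_def]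

/-- The functional I(z) = ∫_𝒪 |z(y)|² dy is a Baire-1 function on a bounded weakly
closed subset X of L²(𝒟; ℝ^N) equipped with the weak L² topology (which on X is
induced by a metric d_X, so continuity below is d_X-continuity); consequently its
set of continuity points is residual in X. -/
theorem stmt18 (d N : ℕ) (𝒟 𝒪 : Set (EuclideanSpace ℝ (Fin d)))
    (h𝒟 : IsOpen 𝒟) (h𝒪 : IsOpen 𝒪) (h𝒪𝒟 : 𝒪 ⊆ 𝒟) (h𝒪bdd : Bornology.IsBounded 𝒪)
    (X : Set (WeakSpace ℝ (Lp (EuclideanSpace ℝ (Fin N)) 2 (volume.restrict 𝒟))))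
    -- X is bounded in L²
    (hXbdd : ∃ R : ℝ, ∀ f ∈ X, wnorm (volume.restrict 𝒟) f ≤ R)
    -- X is closed under weak L² convergence
    (hXclosed : IsClosed X)
    (I : X → ℝ)
    (hI : ∀ f : X, I f = ∫ y in 𝒪, ‖toFun (volume.restrict 𝒟) f.1 y‖ ^ 2) :
    (∃ g : ℕ → X → ℝ, (∀ n, Continuous (g n)) ∧
      ∀ f : X, Tendsto (fun n => g n f) atTop (nhds (I f))) ∧
    {f : X | ContinuousAt I f} ∈ residual X := by
  let μ := (volume : Measure (EuclideanSpace ℝ (Fin d))).restrict 𝒟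
  let T := LpToLpRestrictCLM (EuclideanSpace ℝ (Fin d)) (EuclideanSpace ℝ (Fin N)) ℝ μ 2 𝒪
  have : Fact ((2 : ENNReal) ≠ ⊤) := ⟨by simp⟩
  let y := TopologicalSpace.denseSeq (Lp (EuclideanSpace ℝ (Fin N)) 2 (μ.restrict 𝒪))
  let e := (toWeakSpace ℝ (Lp (EuclideanSpace ℝ (Fin N)) 2 μ)).symm
  have hIT (f : X) : I f = ‖T (e f.1)‖ ^ 2 := by
    have hμ : μ.restrict 𝒪 = volume.restrict 𝒪 := by
      rw [Measure.restrict_restrict h𝒪.measurableSet, Set.inter_eq_left.2 h𝒪𝒟]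
    rw [hI f, L2.norm_sq_eq_integral, ← hμ]
    refine integral_congr_ae ?_
    filter_upwards [LpToLpRestrictCLM_coeFn ℝ 𝒪 (e f.1)] with x hx
    rw [hx]
    rfl
  refine exists_continuous_tendsto_and_residual_of_isLUB
    (a := fun n f => 2 * inner ℝ (y n) (T (e f.1)) - ‖y n‖ ^ 2) (fun n => ?_) fun f => ?_
  · have hφ := WeakSpace.continuous_strongDual_apply ((innerSL ℝ (y n)).comp T)
    exact ((hφ.comp continuous_subtype_val).const_mul 2).sub continuous_const
  · rw [hIT f]
    exact isLUB_range_two_mul_inner_denseSeq_sub (T (e f.1))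
end
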